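/- For every ε > 0, the entropic dual functional D_{σ,ε}(φ,ψ) := ∫ ψ dσ − (f²/(2g)) ∫_Ω φ² dμ − ε ∫_{Ω×ℝ²} (exp((φ(x)+ψ(y)−½‖x−y‖²)/ε) − 1) dμ(x) dσ(y), defined over pairs of continuous functions φ : Ω → ℝ and ψ : supp σ → ℝ, is strictly concave up to almost-everywhere equality, and admits a maximizer (φ_ε, ψ_ε) which is unique in the sense that any two maximizers agree μ-almost everywhere in the first component and σ-almost everywhere in the second. -/

import Mathlib

open MeasureTheory

/-- The (topological) support of a Borel measure: the set of points all of whose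
neighbourhoods have positive measure. -/
def msupport (σ : Measure (EuclideanSpace ℝ (Fin 2))) : Set (EuclideanSpace ℝ (Fin 2)) :=
  { y | ∀ U ∈ nhds y, 0 < σ U }

/-- Admissible pairs for the entropic dual problem: `φ` continuous on `Ω` and `ψ`
continuous on the support of `σ`. -/
def EntAdmissible (Ω : Set (EuclideanSpace ℝ (Fin 2)))
    (σ : Measure (EuclideanSpace ℝ (Fin 2)))
    (φ ψ : EuclideanSpace ℝ (Fin 2) → ℝ) : Prop :=
  ContinuousOn φ Ω ∧ ContinuousOn ψ (msupport σ)

/-- The entropic dual functional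
`D_{σ,ε}(φ,ψ) := ∫ ψ dσ − (f²/(2g)) ∫ φ² dμ
  − ε ∫∫ (exp((φ(x)+ψ(y)−½‖x−y‖²)/ε) − 1) dμ(x) dσ(y)`. -/
noncomputable def Dse (μ σ : Measure (EuclideanSpace ℝ (Fin 2))) (f g ε : ℝ)
    (φ ψ : EuclideanSpace ℝ (Fin 2) → ℝ) : ℝ :=
  (∫ y, ψ y ∂σ) - f ^ 2 / (2 * g) * (∫ x, φ x ^ 2 ∂μ)
    - ε * ∫ p, (Real.exp ((φ p.1 + ψ p.2 - ‖p.1 - p.2‖ ^ 2 / 2) / ε) - 1) ∂(μ.prod σ)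

section ScalarEquation

/-- For `A ≥ 0` the scalar equation `k a + exp (a / ε) A = 0` has a root in `[-A / k, 0]`. -/
theorem exists_root_mul_add_exp {k ε A : ℝ} (hk : 0 < k) (hε : 0 < ε) (hA : 0 ≤ A) :
    ∃ a : ℝ, -(A / k) ≤ a ∧ a ≤ 0 ∧ k * a + Real.exp (a / ε) * A = 0 := by
  have hle : -(A / k) ≤ 0 := by
    have := div_nonneg hA hk.le
    linarith
  have hcont : ContinuousOn (fun a : ℝ => k * a + Real.exp (a / ε) * A)
      (Set.Icc (-(A / k)) 0) := by fun_prop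
  have hmem : (0 : ℝ) ∈ Set.Icc (k * (-(A / k)) + Real.exp (-(A / k) / ε) * A)
      (k * 0 + Real.exp (0 / ε) * A) := by
    constructor
    · have h1 : Real.exp (-(A / k) / ε) ≤ 1 :=
        Real.exp_le_one_iff.2 (div_nonpos_of_nonpos_of_nonneg hle hε.le)
      have h2 : k * (-(A / k)) = -A := by field_simp
      rw [h2]
      nlinarith
    · simpa using hA
  obtain ⟨a, ⟨h1, h2⟩, h3⟩ := intermediate_value_Icc hle hcont hmem
  exact ⟨a, h1, h2, h3⟩

theorem mul_sub_le_of_root_mul_add_exp {k ε A B a b : ℝ} (hε : 0 < ε) (hA : 0 ≤ A)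
    (ha : k * a + Real.exp (a / ε) * A = 0) (hb : k * b + Real.exp (b / ε) * B = 0)
    (hba : b ≤ a) : k * (a - b) ≤ Real.exp (b / ε) * (B - A) := by
  have h : Real.exp (b / ε) ≤ Real.exp (a / ε) :=
    Real.exp_le_exp.2 (div_le_div_of_nonneg_right hba hε.le)
  nlinarith [mul_le_mul_of_nonneg_right h hA]

theorem root_mul_add_exp_anti {k ε A B a b : ℝ} (hk : 0 < k) (hε : 0 < ε) (hA : 0 ≤ A)
    (hBA : B ≤ A)
    (ha : k * a + Real.exp (a / ε) * A = 0) (hb : k * b + Real.exp (b / ε) * B = 0) :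
    a ≤ b := by
  by_contra! h
  have h1 := mul_sub_le_of_root_mul_add_exp hε hA ha hb h.le
  have h2 : Real.exp (b / ε) * (B - A) ≤ 0 :=
    mul_nonpos_of_nonneg_of_nonpos (Real.exp_nonneg _) (by linarith)
  nlinarith

theorem abs_sub_le_of_root_mul_add_exp {k ε A B a b : ℝ} (hk : 0 < k) (hε : 0 < ε)
    (hA : 0 ≤ A) (hB : 0 ≤ B) (ha0 : a ≤ 0) (hb0 : b ≤ 0)
    (ha : k * a + Real.exp (a / ε) * A = 0) (hb : k * b + Real.exp (b / ε) * B = 0) :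
    |a - b| ≤ k⁻¹ * |A - B| := by
  have key : ∀ {A B a b : ℝ}, 0 ≤ A → b ≤ 0 → k * a + Real.exp (a / ε) * A = 0 →
      k * b + Real.exp (b / ε) * B = 0 → b ≤ a → |a - b| ≤ k⁻¹ * |A - B| := by
    intro A B a b hA hb0 ha hb h
    have h1 := mul_sub_le_of_root_mul_add_exp hε hA ha hb h
    have h2 : Real.exp (b / ε) ≤ 1 :=
      Real.exp_le_one_iff.2 (div_nonpos_of_nonpos_of_nonneg hb0 hε.le)
    have h3 : Real.exp (b / ε) * (B - A) ≤ |A - B| := by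
      calc Real.exp (b / ε) * (B - A) ≤ Real.exp (b / ε) * |A - B| :=
            mul_le_mul_of_nonneg_left (by rw [abs_sub_comm]; exact le_abs_self _)
              (Real.exp_nonneg _)
        _ ≤ |A - B| := mul_le_of_le_one_left (abs_nonneg _) h2
    rw [abs_of_nonneg (sub_nonneg.2 h), le_inv_mul_iff₀ hk]
    exact h1.trans h3
  rcases le_total b a with h | h
  · exact key hA hb0 ha hb h
  · rw [abs_sub_comm a, abs_sub_comm A]
    exact key hB ha0 hb ha h

/-- The root of `k a + exp (a / ε) A = 0` is a bounded, antitone, continuous function of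
`A ≥ 0`. -/
theorem exists_root_function {k ε : ℝ} (hk : 0 < k) (hε : 0 < ε) :
    ∃ s : ℝ → ℝ, Continuous s ∧ Antitone s ∧ (∀ A, s A ≤ 0) ∧ (∀ A, 0 ≤ A → -(A / k) ≤ s A) ∧
      ∀ A, 0 ≤ A → k * s A + Real.exp (s A / ε) * A = 0 := by
  choose r hr1 hr2 hr3 using fun A : ℝ =>
    exists_root_mul_add_exp (A := max A 0) hk hε (le_max_right A 0)
  refine ⟨r, ?_, ?_, hr2, ?_, ?_⟩
  · refine (LipschitzWith.of_dist_le_mul (K := ⟨k⁻¹, by positivity⟩) fun A B => ?_).continuous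
    rw [Real.dist_eq, Real.dist_eq]
    refine (abs_sub_le_of_root_mul_add_exp hk hε (le_max_right A 0) (le_max_right B 0)
      (hr2 A) (hr2 B) (hr3 A) (hr3 B)).trans ?_
    exact mul_le_mul_of_nonneg_left (abs_max_sub_max_le_abs A B 0) (by positivity)
  · intro A B hAB
    exact root_mul_add_exp_anti hk hε (le_max_right B 0) (max_le_max_right 0 hAB)
      (hr3 B) (hr3 A)
  · intro A hA
    simpa [max_eq_left hA] using hr1 A
  · intro A hA
    simpa [max_eq_left hA] using hr3 A

end ScalarEquation

section GibbsWeights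

variable {X Y : Type*} {c : X → Y → ℝ} {ε : ℝ}

/-- The partition function `y ↦ ∫ exp ((φ(x) - c(x,y)) / ε) dμ(x)`. -/
noncomputable def gibbsWeight [MeasurableSpace X] (μ : Measure X) (c : X → Y → ℝ) (ε : ℝ) (φ : X → ℝ) (y : Y) : ℝ :=
  ∫ x, Real.exp ((φ x - c x y) / ε) ∂μ

/-- The marginal `x ↦ ∫ exp (-c(x,y) / ε) / w(y) dσ(y)` for a weight `w`. -/
noncomputable def gibbsMarginal [MeasurableSpace Y] (σ : Measure Y) (c : X → Y → ℝ) (ε : ℝ) (w : Y → ℝ) (x : X) : ℝ :=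
  ∫ y, Real.exp (-c x y / ε) / w y ∂σ

theorem gibbs_exp_le_one (hc0 : ∀ x y, 0 ≤ c x y) (hε : 0 < ε) {a : ℝ} (ha : a ≤ 0)
    (x : X) (y : Y) : Real.exp ((a - c x y) / ε) ≤ 1 :=
  Real.exp_le_one_iff.2 (div_nonpos_of_nonpos_of_nonneg (by linarith [hc0 x y]) hε.le)

theorem norm_exp_div_le_inv (hc0 : ∀ x y, 0 ≤ c x y) (hε : 0 < ε) {w : Y → ℝ}
    (hw : ∀ y, 0 < w y) (x : X) (y : Y) : ‖Real.exp (-c x y / ε) / w y‖ ≤ (w y)⁻¹ := by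
  rw [Real.norm_eq_abs, abs_of_nonneg (div_nonneg (Real.exp_nonneg _) (hw y).le), div_eq_mul_inv]
  refine mul_le_of_le_one_left (inv_nonneg.2 (hw y).le) ?_
  simpa using gibbs_exp_le_one hc0 hε le_rfl x y

theorem gibbsWeight_const [MeasurableSpace X] {μ : Measure X} (a : ℝ) (y : Y) :
    gibbsWeight μ c ε (fun _ => a) y = Real.exp (a / ε) * gibbsWeight μ c ε (fun _ => 0) y := by
  unfold gibbsWeight
  rw [← integral_const_mul]
  congr 1 with x
  rw [← Real.exp_add]
  congr 1
  ring

theorem gibbsMarginal_nonneg [MeasurableSpace Y] {σ : Measure Y} {w : Y → ℝ} (hw0 : ∀ y, 0 < w y)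
    (x : X) :
    0 ≤ gibbsMarginal σ c ε w x :=
  integral_nonneg fun y => div_nonneg (Real.exp_nonneg _) (hw0 y).le

theorem gibbsMarginal_const_mul [MeasurableSpace Y] {σ : Measure Y} (a : ℝ) (w : Y → ℝ) (x : X) :
    gibbsMarginal σ c ε (fun y => a * w y) x = a⁻¹ * gibbsMarginal σ c ε w x := by
  unfold gibbsMarginal
  rw [← integral_const_mul]
  congr 1 with y
  rw [div_eq_mul_inv, div_eq_mul_inv, mul_inv]
  ring

theorem integrable_of_continuousOn_of_ae_mem {Z : Type*} [TopologicalSpace Z] [T2Space Z]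
    [MeasurableSpace Z] [OpensMeasurableSpace Z] {ν : Measure Z} [IsFiniteMeasure ν] {S : Set Z}
    (hS : IsCompact S) (hν : ∀ᵐ z ∂ν, z ∈ S) {u : Z → ℝ} (hu : ContinuousOn u S) :
    Integrable u ν := by
  have h := hu.integrableOn_compact (μ := ν) hS
  rwa [IntegrableOn, Measure.restrict_eq_self_of_ae_mem hν] at h

variable [TopologicalSpace X] [TopologicalSpace Y]

theorem continuous_exp_div (hc : Continuous (Function.uncurry c)) {w : Y → ℝ}
    (hw : Continuous w) (hw0 : ∀ y, 0 < w y) (x : X) :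
    Continuous fun y => Real.exp (-c x y / ε) / w y := by
  have h : Continuous fun y => c x y := hc.comp (continuous_const.prodMk continuous_id)
  exact Continuous.div (by fun_prop) hw fun y => (hw0 y).ne'

section Weight

variable [MeasurableSpace X] [OpensMeasurableSpace X] {μ : Measure X}

theorem measurable_gibbs_exp (hc : Continuous (Function.uncurry c)) {φ : X → ℝ}
    (hφ : Measurable φ) (y : Y) : Measurable fun x => Real.exp ((φ x - c x y) / ε) := by
  have h : Measurable fun x => c x y :=
    (hc.comp (continuous_id.prodMk continuous_const)).measurable
  fun_prop

theorem integrable_gibbs_exp [IsFiniteMeasure μ] (hc : Continuous (Function.uncurry c))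
    (hc0 : ∀ x y, 0 ≤ c x y) (hε : 0 < ε) {φ : X → ℝ} (hφ : Measurable φ)
    (hφ0 : ∀ x, φ x ≤ 0) (y : Y) : Integrable (fun x => Real.exp ((φ x - c x y) / ε)) μ := by
  refine Integrable.of_bound (measurable_gibbs_exp hc hφ y).aestronglyMeasurable 1
    (ae_of_all _ fun x => ?_)
  rw [Real.norm_eq_abs, Real.abs_exp]
  exact gibbs_exp_le_one hc0 hε (hφ0 x) x y

theorem continuous_gibbsWeight [FirstCountableTopology Y] [IsFiniteMeasure μ]
    (hc : Continuous (Function.uncurry c)) (hc0 : ∀ x y, 0 ≤ c x y) (hε : 0 < ε) {φ : X → ℝ}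
    (hφ : Measurable φ) (hφ0 : ∀ x, φ x ≤ 0) : Continuous (gibbsWeight μ c ε φ) := by
  refine continuous_of_dominated (bound := fun _ => 1)
    (fun y => (measurable_gibbs_exp hc hφ y).aestronglyMeasurable)
    (fun y => ae_of_all _ fun x => ?_) (integrable_const _) (ae_of_all _ fun x => ?_)
  · rw [Real.norm_eq_abs, Real.abs_exp]
    exact gibbs_exp_le_one hc0 hε (hφ0 x) x y
  · have h : Continuous fun y => c x y := hc.comp (continuous_const.prodMk continuous_id)
    fun_prop

theorem gibbsWeight_pos [IsProbabilityMeasure μ] (hc : Continuous (Function.uncurry c))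
    (hc0 : ∀ x y, 0 ≤ c x y) (hε : 0 < ε) {φ : X → ℝ} (hφ : Measurable φ)
    (hφ0 : ∀ x, φ x ≤ 0) (y : Y) : 0 < gibbsWeight μ c ε φ y :=
  integral_exp_pos (integrable_gibbs_exp hc hc0 hε hφ hφ0 y)

theorem gibbsWeight_mono [IsFiniteMeasure μ] (hc : Continuous (Function.uncurry c))
    (hc0 : ∀ x y, 0 ≤ c x y) (hε : 0 < ε) {φ₁ φ₂ : X → ℝ} (hφ₁ : Measurable φ₁)
    (hφ₂ : Measurable φ₂) (h : ∀ x, φ₁ x ≤ φ₂ x) (h0 : ∀ x, φ₂ x ≤ 0) (y : Y) :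
    gibbsWeight μ c ε φ₁ y ≤ gibbsWeight μ c ε φ₂ y := by
  refine integral_mono (integrable_gibbs_exp hc hc0 hε hφ₁ (fun x => (h x).trans (h0 x)) y)
    (integrable_gibbs_exp hc hc0 hε hφ₂ h0 y) fun x => ?_
  exact Real.exp_le_exp.2 (div_le_div_of_nonneg_right (by linarith [h x]) hε.le)

end Weight

section Marginal

variable [MeasurableSpace Y] [OpensMeasurableSpace Y] {σ : Measure Y}

theorem continuous_gibbsMarginal [FirstCountableTopology X]
    (hc : Continuous (Function.uncurry c)) (hc0 : ∀ x y, 0 ≤ c x y) (hε : 0 < ε) {w : Y → ℝ}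
    (hw : Continuous w) (hw0 : ∀ y, 0 < w y) (hwi : Integrable (fun y => (w y)⁻¹) σ) :
    Continuous (gibbsMarginal σ c ε w) := by
  refine continuous_of_dominated (bound := fun y => (w y)⁻¹)
    (fun x => (continuous_exp_div hc hw hw0 x).measurable.aestronglyMeasurable)
    (fun x => ae_of_all _ (norm_exp_div_le_inv hc0 hε hw0 x)) hwi (ae_of_all _ fun y => ?_)
  have h : Continuous fun x => c x y := hc.comp (continuous_id.prodMk continuous_const)
  fun_prop

theorem integrable_exp_div (hc : Continuous (Function.uncurry c)) (hc0 : ∀ x y, 0 ≤ c x y)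
    (hε : 0 < ε) {w : Y → ℝ} (hw : Continuous w) (hw0 : ∀ y, 0 < w y)
    (hwi : Integrable (fun y => (w y)⁻¹) σ) (x : X) :
    Integrable (fun y => Real.exp (-c x y / ε) / w y) σ :=
  hwi.mono' (continuous_exp_div hc hw hw0 x).measurable.aestronglyMeasurable
    (ae_of_all _ (norm_exp_div_le_inv hc0 hε hw0 x))

theorem gibbsMarginal_anti (hc : Continuous (Function.uncurry c)) (hc0 : ∀ x y, 0 ≤ c x y)
    (hε : 0 < ε) {w₁ w₂ : Y → ℝ} (hw₁ : Continuous w₁) (hw₂ : Continuous w₂)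
    (hpos₁ : ∀ y, 0 < w₁ y) (hpos₂ : ∀ y, 0 < w₂ y) (h₁ : Integrable (fun y => (w₁ y)⁻¹) σ)
    (h₂ : Integrable (fun y => (w₂ y)⁻¹) σ) (h : ∀ y, w₁ y ≤ w₂ y) (x : X) :
    gibbsMarginal σ c ε w₂ x ≤ gibbsMarginal σ c ε w₁ x :=
  integral_mono (integrable_exp_div hc hc0 hε hw₂ hpos₂ h₂ x)
    (integrable_exp_div hc hc0 hε hw₁ hpos₁ h₁ x) fun y =>
      div_le_div_of_nonneg_left (Real.exp_nonneg _) (hpos₁ y) (h y)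

theorem gibbsMarginal_le_integral_inv (hc : Continuous (Function.uncurry c))
    (hc0 : ∀ x y, 0 ≤ c x y) (hε : 0 < ε) {w : Y → ℝ} (hw : Continuous w) (hw0 : ∀ y, 0 < w y)
    (hwi : Integrable (fun y => (w y)⁻¹) σ) (x : X) :
    gibbsMarginal σ c ε w x ≤ ∫ y, (w y)⁻¹ ∂σ :=
  integral_mono (integrable_exp_div hc hc0 hε hw hw0 hwi x) hwi fun y =>
    (le_abs_self _).trans (norm_exp_div_le_inv hc0 hε hw0 x y)

end Marginal

/-- Existence of a solution of the entropic optimality system, obtained by monotone iteration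
from the upper solution `0`. -/
theorem exists_optimality_system [MeasurableSpace X] [OpensMeasurableSpace X]
    [MeasurableSpace Y] [OpensMeasurableSpace Y] {μ : Measure X} {σ : Measure Y}
    [FirstCountableTopology X] [FirstCountableTopology Y]
    [T2Space Y] [IsProbabilityMeasure μ] [IsFiniteMeasure σ]
    (hc : Continuous (Function.uncurry c)) (hc0 : ∀ x y, 0 ≤ c x y) (hε : 0 < ε)
    {K : Set Y} (hK : IsCompact K) (hσK : ∀ᵐ y ∂σ, y ∈ K) {k : ℝ} (hk : 0 < k) :
    ∃ φ : X → ℝ, Continuous φ ∧ Continuous (gibbsWeight μ c ε φ) ∧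
      (∀ y, 0 < gibbsWeight μ c ε φ y) ∧
      ∀ x, k * φ x + Real.exp (φ x / ε) * gibbsMarginal σ c ε (gibbsWeight μ c ε φ) x = 0 := by
  obtain ⟨s, hs_cont, hs_anti, hs_nonpos, hs_ge, hs_root⟩ := exists_root_function hk hε
  set W : (X → ℝ) → Y → ℝ := gibbsWeight μ c ε
  set F : (X → ℝ) → X → ℝ := fun φ x => s (gibbsMarginal σ c ε (W φ) x)
  have hW_cont : ∀ {φ : X → ℝ}, Measurable φ → (∀ x, φ x ≤ 0) → Continuous (W φ) :=
    fun hφ h0 => continuous_gibbsWeight hc hc0 hε hφ h0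
  have hW_pos : ∀ {φ : X → ℝ}, Measurable φ → (∀ x, φ x ≤ 0) → ∀ y, 0 < W φ y :=
    fun hφ h0 => gibbsWeight_pos hc hc0 hε hφ h0
  have hW_int : ∀ {φ : X → ℝ}, Measurable φ → (∀ x, φ x ≤ 0) →
      Integrable (fun y => (W φ y)⁻¹) σ := fun hφ h0 =>
    integrable_of_continuousOn_of_ae_mem hK hσK
      ((hW_cont hφ h0).inv₀ fun y => (hW_pos hφ h0 y).ne').continuousOn
  have hF_cont : ∀ {φ : X → ℝ}, Measurable φ → (∀ x, φ x ≤ 0) → Continuous (F φ) :=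
    fun hφ h0 => hs_cont.comp
      (continuous_gibbsMarginal hc hc0 hε (hW_cont hφ h0) (hW_pos hφ h0) (hW_int hφ h0))
  have hF_mono : ∀ {φ₁ φ₂ : X → ℝ}, Measurable φ₁ → Measurable φ₂ → (∀ x, φ₁ x ≤ φ₂ x) →
      (∀ x, φ₂ x ≤ 0) → ∀ x, F φ₁ x ≤ F φ₂ x := by
    intro φ₁ φ₂ h₁ h₂ h h0 x
    have h0' : ∀ x, φ₁ x ≤ 0 := fun x => (h x).trans (h0 x)
    exact hs_anti (gibbsMarginal_anti hc hc0 hε (hW_cont h₁ h0') (hW_cont h₂ h0)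
      (hW_pos h₁ h0') (hW_pos h₂ h0) (hW_int h₁ h0') (hW_int h₂ h0)
      (gibbsWeight_mono hc hc0 hε h₁ h₂ h h0) x)
  have hz : Measurable fun _ : X => (0 : ℝ) := measurable_const
  have hz0 : ∀ x : X, (fun _ : X => (0 : ℝ)) x ≤ 0 := fun _ => le_rfl
  set M : ℝ := (∫ y, (W (fun _ => 0) y)⁻¹ ∂σ) / k with hM
  have hM0 : 0 ≤ M := div_nonneg (integral_nonneg fun y => inv_nonneg.2 (hW_pos hz hz0 y).le) hk.le
  have hlow : ∀ x, -M ≤ F (fun _ => -M) x := by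
    intro x
    have hA : gibbsMarginal σ c ε (W fun _ => -M) x
        = Real.exp (M / ε) * gibbsMarginal σ c ε (W fun _ => 0) x := by
      have : (W fun _ => -M) = fun y => Real.exp (-M / ε) * W (fun _ => 0) y := by
        funext y
        exact gibbsWeight_const (-M) y
      rw [this, gibbsMarginal_const_mul, ← Real.exp_neg]
      congr 2
      ring
    have hroot := hs_root _ (gibbsMarginal_nonneg (σ := σ) (c := c) (ε := ε)
      (hW_pos (φ := fun _ => -M) measurable_const fun _ => by linarith) x)
    have hA0 := gibbsMarginal_nonneg (σ := σ) (c := c) (ε := ε) (hW_pos hz hz0) x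
    have hle := gibbsMarginal_le_integral_inv hc hc0 hε (hW_cont hz hz0) (hW_pos hz hz0)
      (hW_int hz hz0) x
    change k * F (fun _ => -M) x + Real.exp (F (fun _ => -M) x / ε) * _ = 0 at hroot
    rw [hA] at hroot
    by_contra! hlt
    have h1 : Real.exp (F (fun _ => -M) x / ε) * Real.exp (M / ε) ≤ 1 := by
      rw [← Real.exp_add, ← add_div]
      exact Real.exp_le_one_iff.2 (div_nonpos_of_nonpos_of_nonneg (by linarith) hε.le)
    have h2 := mul_le_of_le_one_left hA0 h1
    have h3 : k * M = ∫ y, (W (fun _ => 0) y)⁻¹ ∂σ := by rw [hM]; field_simp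
    nlinarith
  set u : ℕ → X → ℝ := fun n => F^[n] (fun _ => 0) with hu
  have hu_succ : ∀ n, u (n + 1) = F (u n) := fun n => Function.iterate_succ_apply' F n _
  have hu_prop : ∀ n, Measurable (u n) ∧ (∀ x, u n x ≤ 0) ∧ ∀ x, -M ≤ u n x := by
    intro n
    induction n with
    | zero => exact ⟨hz, hz0, fun x => by simpa [hu] using hM0⟩
    | succ n ih =>
      obtain ⟨h1, h2, h3⟩ := ih
      rw [hu_succ]
      exact ⟨(hF_cont h1 h2).measurable, fun x => hs_nonpos _,
        fun x => (hlow x).trans (hF_mono measurable_const h1 h3 h2 x)⟩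
  have hu_step : ∀ n x, u (n + 1) x ≤ u n x := by
    intro n
    induction n with
    | zero => intro x; rw [hu_succ]; exact hs_nonpos _
    | succ n ih =>
      intro x
      have h := hF_mono (hu_prop (n + 1)).1 (hu_prop n).1 ih (hu_prop n).2.1 x
      rwa [← hu_succ, ← hu_succ] at h
  have hu_bdd : ∀ x, BddBelow (Set.range fun n => u n x) := fun x =>
    ⟨-M, by rintro _ ⟨n, rfl⟩; exact (hu_prop n).2.2 x⟩
  set v : X → ℝ := fun x => ⨅ n, u n x
  have hlim : ∀ x, Filter.Tendsto (fun n => u n x) Filter.atTop (nhds (v x)) := fun x =>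
    tendsto_atTop_ciInf (antitone_nat_of_succ_le fun n => hu_step n x) (hu_bdd x)
  have hv_meas : Measurable v :=
    measurable_of_tendsto_metrizable (fun n => (hu_prop n).1) (tendsto_pi_nhds.2 hlim)
  have hv_le : ∀ n x, v x ≤ u n x := fun n x => ciInf_le (hu_bdd x) n
  have hv0 : ∀ x, v x ≤ 0 := fun x => (hv_le 0 x).trans ((hu_prop 0).2.1 x)
  have hW_lim : ∀ y, Filter.Tendsto (fun n => W (u n) y) Filter.atTop (nhds (W v y)) := by
    intro y
    refine tendsto_integral_of_dominated_convergence (fun _ => 1)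
      (fun n => (measurable_gibbs_exp hc (hu_prop n).1 y).aestronglyMeasurable)
      (integrable_const _) (fun n => ae_of_all _ fun x => ?_) (ae_of_all _ fun x => ?_)
    · rw [Real.norm_eq_abs, Real.abs_exp]
      exact gibbs_exp_le_one hc0 hε ((hu_prop n).2.1 x) x y
    · exact (Real.continuous_exp.tendsto _).comp (((hlim x).sub_const _).div_const _)
  have hA_lim : ∀ x, Filter.Tendsto (fun n => gibbsMarginal σ c ε (W (u n)) x) Filter.atTop
      (nhds (gibbsMarginal σ c ε (W v) x)) := by
    intro x
    refine tendsto_integral_of_dominated_convergence (fun y => (W v y)⁻¹)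
      (fun n => (continuous_exp_div hc (hW_cont (hu_prop n).1 (hu_prop n).2.1)
        (hW_pos (hu_prop n).1 (hu_prop n).2.1) x).measurable.aestronglyMeasurable)
      (hW_int hv_meas hv0) (fun n => ae_of_all _ fun y => ?_) (ae_of_all _ fun y => ?_)
    · refine (norm_exp_div_le_inv hc0 hε (hW_pos (hu_prop n).1 (hu_prop n).2.1) x y).trans ?_
      exact inv_anti₀ (hW_pos hv_meas hv0 y)
        (gibbsWeight_mono hc hc0 hε hv_meas (hu_prop n).1 (hv_le n) (hu_prop n).2.1 y)
    · exact tendsto_const_nhds.div (hW_lim y) (hW_pos hv_meas hv0 y).ne'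
  have hfix : F v = v := by
    funext x
    refine tendsto_nhds_unique ?_ ((Filter.tendsto_add_atTop_iff_nat 1).2 (hlim x))
    simp only [hu_succ]
    exact (hs_cont.tendsto _).comp (hA_lim x)
  refine ⟨v, hfix ▸ hF_cont hv_meas hv0, hW_cont hv_meas hv0, hW_pos hv_meas hv0, fun x => ?_⟩
  have h := hs_root _ (gibbsMarginal_nonneg (σ := σ) (c := c) (ε := ε) (hW_pos hv_meas hv0) x)
  have hx : s (gibbsMarginal σ c ε (W v) x) = v x := congrFun hfix x
  rwa [hx] at h

end GibbsWeights

section PointwiseConcavity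

/-- The pointwise integrand of the entropic dual functional, with `κ = f² / (2g)` and cost
value `r`. -/
noncomputable def entropicIntegrand (κ ε r a b : ℝ) : ℝ :=
  b - κ * a ^ 2 - ε * (Real.exp ((a + b - r) / ε) - 1)

theorem entropicIntegrand_concave {κ ε : ℝ} (hκ : 0 < κ) (hε : 0 < ε) (r a₁ b₁ a₂ b₂ : ℝ)
    {t : ℝ} (ht0 : 0 < t) (ht1 : t < 1) :
    t * entropicIntegrand κ ε r a₁ b₁ + (1 - t) * entropicIntegrand κ ε r a₂ b₂ ≤
      entropicIntegrand κ ε r (t * a₁ + (1 - t) * a₂) (t * b₁ + (1 - t) * b₂) ∧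
    (t * entropicIntegrand κ ε r a₁ b₁ + (1 - t) * entropicIntegrand κ ε r a₂ b₂ =
      entropicIntegrand κ ε r (t * a₁ + (1 - t) * a₂) (t * b₁ + (1 - t) * b₂) →
      a₁ = a₂ ∧ b₁ = b₂) := by
  have hu : (t * a₁ + (1 - t) * a₂ + (t * b₁ + (1 - t) * b₂) - r) / ε =
      t * ((a₁ + b₁ - r) / ε) + (1 - t) * ((a₂ + b₂ - r) / ε) := by
    field_simp
    ring
  have ht1' : 0 < 1 - t := sub_pos.2 ht1
  have hexp : Real.exp (t * ((a₁ + b₁ - r) / ε) + (1 - t) * ((a₂ + b₂ - r) / ε)) ≤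
      t * Real.exp ((a₁ + b₁ - r) / ε) + (1 - t) * Real.exp ((a₂ + b₂ - r) / ε) := by
    simpa using convexOn_exp.2 (Set.mem_univ ((a₁ + b₁ - r) / ε))
      (Set.mem_univ ((a₂ + b₂ - r) / ε)) ht0.le ht1'.le (by ring)
  have hgap : entropicIntegrand κ ε r (t * a₁ + (1 - t) * a₂) (t * b₁ + (1 - t) * b₂) -
      (t * entropicIntegrand κ ε r a₁ b₁ + (1 - t) * entropicIntegrand κ ε r a₂ b₂) =
      κ * (t * (1 - t)) * (a₁ - a₂) ^ 2 +
      ε * (t * Real.exp ((a₁ + b₁ - r) / ε) + (1 - t) * Real.exp ((a₂ + b₂ - r) / ε) -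
        Real.exp (t * ((a₁ + b₁ - r) / ε) + (1 - t) * ((a₂ + b₂ - r) / ε))) := by
    simp only [entropicIntegrand, hu]
    ring
  have h1 : 0 ≤ κ * (t * (1 - t)) * (a₁ - a₂) ^ 2 := by positivity
  have h2 := mul_nonneg hε.le (sub_nonneg.2 hexp)
  refine ⟨by linarith, fun heq => ?_⟩
  have h3 : κ * (t * (1 - t)) * (a₁ - a₂) ^ 2 = 0 := by linarith
  have h4 : a₁ = a₂ := by
    have : (a₁ - a₂) ^ 2 = 0 := by
      refine (mul_eq_zero.1 h3).resolve_left (by positivity)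
    exact sub_eq_zero.1 (pow_eq_zero_iff two_ne_zero |>.1 this)
  refine ⟨h4, ?_⟩
  by_contra hb
  have hne : (a₁ + b₁ - r) / ε ≠ (a₂ + b₂ - r) / ε := by
    intro h
    rw [div_left_inj' hε.ne', h4] at h
    exact hb (by linarith)
  have hlt : Real.exp (t * ((a₁ + b₁ - r) / ε) + (1 - t) * ((a₂ + b₂ - r) / ε)) <
      t * Real.exp ((a₁ + b₁ - r) / ε) + (1 - t) * Real.exp ((a₂ + b₂ - r) / ε) := by
    simpa using strictConvexOn_exp.2 (Set.mem_univ ((a₁ + b₁ - r) / ε))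
      (Set.mem_univ ((a₂ + b₂ - r) / ε)) hne ht0 ht1' (by ring)
  have h5 := mul_pos hε (sub_pos.2 hlt)
  linarith

/-- The tangent-plane inequality for the concave integrand. -/
theorem entropicIntegrand_le_tangent {κ ε : ℝ} (hκ : 0 < κ) (hε : 0 < ε) (r a b a₀ b₀ : ℝ) :
    entropicIntegrand κ ε r a b ≤ entropicIntegrand κ ε r a₀ b₀ +
      ((b - b₀) * (1 - Real.exp ((a₀ + b₀ - r) / ε)) -
        (a - a₀) * (2 * κ * a₀ + Real.exp ((a₀ + b₀ - r) / ε))) := by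
  have hexp : Real.exp ((a + b - r) / ε) =
      Real.exp ((a₀ + b₀ - r) / ε) * Real.exp ((a + b - (a₀ + b₀)) / ε) := by
    rw [← Real.exp_add]
    congr 1
    ring
  have h1 := mul_le_mul_of_nonneg_left (Real.add_one_le_exp ((a + b - (a₀ + b₀)) / ε))
    (mul_nonneg hε.le (Real.exp_nonneg ((a₀ + b₀ - r) / ε)))
  have h2 : ε * Real.exp ((a₀ + b₀ - r) / ε) * ((a + b - (a₀ + b₀)) / ε + 1) =
      Real.exp ((a₀ + b₀ - r) / ε) * (a + b - (a₀ + b₀)) +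
        ε * Real.exp ((a₀ + b₀ - r) / ε) := by
    field_simp
  have h3 := mul_nonneg hκ.le (sq_nonneg (a - a₀))
  simp only [entropicIntegrand, hexp]
  nlinarith

end PointwiseConcavity

section EntropicDual

theorem msupport_eq_support (σ : Measure (EuclideanSpace ℝ (Fin 2))) :
    msupport σ = σ.support := by
  ext y
  exact (Measure.mem_support_iff_forall y).symm

theorem isCompact_msupport {σ : Measure (EuclideanSpace ℝ (Fin 2))}
    (hσ : ∃ K, IsCompact K ∧ σ Kᶜ = 0) : IsCompact (msupport σ) := by
  obtain ⟨K, hK, hσK⟩ := hσ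
  refine hK.of_isClosed_subset (msupport_eq_support σ ▸ Measure.isClosed_support) fun y hy => ?_
  by_contra hyK
  exact (hy _ (hK.isClosed.isOpen_compl.mem_nhds hyK)).ne' hσK

theorem ae_mem_msupport (σ : Measure (EuclideanSpace ℝ (Fin 2))) : ∀ᵐ y ∂σ, y ∈ msupport σ := by
  rw [msupport_eq_support]
  exact Measure.support_mem_ae

variable {Ω : Set (EuclideanSpace ℝ (Fin 2))} {μ σ : Measure (EuclideanSpace ℝ (Fin 2))}
  {f g ε : ℝ} {φ ψ : EuclideanSpace ℝ (Fin 2) → ℝ}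

theorem ae_prod_mem_msupport [SFinite μ] [SFinite σ] (hμ : ∀ᵐ x ∂μ, x ∈ Ω) :
    ∀ᵐ p ∂μ.prod σ, p ∈ Ω ×ˢ msupport σ := by
  filter_upwards [Measure.quasiMeasurePreserving_fst.ae hμ,
    Measure.quasiMeasurePreserving_snd.ae (ae_mem_msupport σ)] with p h1 h2 using ⟨h1, h2⟩

theorem EntAdmissible.continuousOn_fst (h : EntAdmissible Ω σ φ ψ) :
    ContinuousOn (fun p : EuclideanSpace ℝ (Fin 2) × EuclideanSpace ℝ (Fin 2) => φ p.1)
      (Ω ×ˢ msupport σ) :=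
  h.1.comp _root_.continuousOn_fst fun _ hp => hp.1

theorem EntAdmissible.continuousOn_snd (h : EntAdmissible Ω σ φ ψ) :
    ContinuousOn (fun p : EuclideanSpace ℝ (Fin 2) × EuclideanSpace ℝ (Fin 2) => ψ p.2)
      (Ω ×ˢ msupport σ) :=
  h.2.comp _root_.continuousOn_snd fun _ hp => hp.2

theorem EntAdmissible.continuousOn_exp (h : EntAdmissible Ω σ φ ψ) :
    ContinuousOn (fun p : EuclideanSpace ℝ (Fin 2) × EuclideanSpace ℝ (Fin 2) =>
      Real.exp ((φ p.1 + ψ p.2 - ‖p.1 - p.2‖ ^ 2 / 2) / ε)) (Ω ×ˢ msupport σ) := by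
  have h1 := h.continuousOn_fst
  have h2 := h.continuousOn_snd
  have h3 : ContinuousOn (fun p : EuclideanSpace ℝ (Fin 2) × EuclideanSpace ℝ (Fin 2) =>
      ‖p.1 - p.2‖ ^ 2 / 2) (Ω ×ˢ msupport σ) := by fun_prop
  exact Real.continuous_exp.comp_continuousOn (((h1.add h2).sub h3).div_const ε)

theorem EntAdmissible.continuousOn_entropicIntegrand (h : EntAdmissible Ω σ φ ψ) (κ : ℝ) :
    ContinuousOn (fun p : EuclideanSpace ℝ (Fin 2) × EuclideanSpace ℝ (Fin 2) =>
      entropicIntegrand κ ε (‖p.1 - p.2‖ ^ 2 / 2) (φ p.1) (ψ p.2)) (Ω ×ˢ msupport σ) :=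
  (h.continuousOn_snd.sub (continuousOn_const.mul (h.continuousOn_fst.pow 2))).sub
    (continuousOn_const.mul (h.continuousOn_exp.sub continuousOn_const))

theorem EntAdmissible.convexComb {φ₁ ψ₁ φ₂ ψ₂ : EuclideanSpace ℝ (Fin 2) → ℝ}
    (h₁ : EntAdmissible Ω σ φ₁ ψ₁) (h₂ : EntAdmissible Ω σ φ₂ ψ₂) (t : ℝ) :
    EntAdmissible Ω σ (fun x => t * φ₁ x + (1 - t) * φ₂ x)
      (fun y => t * ψ₁ y + (1 - t) * ψ₂ y) :=
  ⟨(continuousOn_const.mul h₁.1).add (continuousOn_const.mul h₂.1),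
    (continuousOn_const.mul h₁.2).add (continuousOn_const.mul h₂.2)⟩

variable [IsProbabilityMeasure μ] [IsProbabilityMeasure σ]

theorem integrable_prod_of_continuousOn (hΩ : IsCompact Ω) (hμ : ∀ᵐ x ∂μ, x ∈ Ω)
    (hσ : IsCompact (msupport σ))
    {u : EuclideanSpace ℝ (Fin 2) × EuclideanSpace ℝ (Fin 2) → ℝ}
    (hu : ContinuousOn u (Ω ×ˢ msupport σ)) : Integrable u (μ.prod σ) :=
  integrable_of_continuousOn_of_ae_mem (hΩ.prod hσ) (ae_prod_mem_msupport hμ) hu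

/-- The entropic dual functional is the integral of the pointwise integrand. -/
theorem EntAdmissible.Dse_eq_integral (h : EntAdmissible Ω σ φ ψ) (hΩ : IsCompact Ω)
    (hμ : ∀ᵐ x ∂μ, x ∈ Ω) (hσ : IsCompact (msupport σ)) :
    Dse μ σ f g ε φ ψ = ∫ p, entropicIntegrand (f ^ 2 / (2 * g)) ε
      (‖p.1 - p.2‖ ^ 2 / 2) (φ p.1) (ψ p.2) ∂(μ.prod σ) := by
  have hi1 := integrable_prod_of_continuousOn hΩ hμ hσ h.continuousOn_snd
  have hi2 : Integrable (fun p => φ p.1 ^ 2) (μ.prod σ) :=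
    integrable_prod_of_continuousOn hΩ hμ hσ (h.continuousOn_fst.pow 2)
  have hi3 : Integrable (fun p =>
      Real.exp ((φ p.1 + ψ p.2 - ‖p.1 - p.2‖ ^ 2 / 2) / ε) - 1) (μ.prod σ) :=
    integrable_prod_of_continuousOn hΩ hμ hσ (h.continuousOn_exp.sub continuousOn_const)
  have hi12 : Integrable (fun p => ψ p.2 - f ^ 2 / (2 * g) * φ p.1 ^ 2) (μ.prod σ) :=
    hi1.sub (hi2.const_mul _)
  have e1 : ∫ p, ψ p.2 ∂(μ.prod σ) = ∫ y, ψ y ∂σ := by simp [integral_fun_snd]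
  have e2 : ∫ p, φ p.1 ^ 2 ∂(μ.prod σ) = ∫ x, φ x ^ 2 ∂μ := by
    simp [integral_fun_fst (fun x => φ x ^ 2)]
  unfold Dse entropicIntegrand
  rw [integral_sub hi12 (hi3.const_mul ε),
    integral_sub hi1 (hi2.const_mul _), integral_const_mul, integral_const_mul, e1, e2]

theorem Dse_strictConcave (hΩ : IsCompact Ω) (hμ : ∀ᵐ x ∂μ, x ∈ Ω)
    (hσ : IsCompact (msupport σ)) (hf : 0 < f) (hg : 0 < g) (hε : 0 < ε)
    {φ₁ ψ₁ φ₂ ψ₂ : EuclideanSpace ℝ (Fin 2) → ℝ} (h₁ : EntAdmissible Ω σ φ₁ ψ₁)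
    (h₂ : EntAdmissible Ω σ φ₂ ψ₂) (hne : ¬(φ₁ =ᵐ[μ] φ₂ ∧ ψ₁ =ᵐ[σ] ψ₂)) {t : ℝ}
    (ht0 : 0 < t) (ht1 : t < 1) :
    t * Dse μ σ f g ε φ₁ ψ₁ + (1 - t) * Dse μ σ f g ε φ₂ ψ₂ <
      Dse μ σ f g ε (fun x => t * φ₁ x + (1 - t) * φ₂ x)
        (fun y => t * ψ₁ y + (1 - t) * ψ₂ y) := by
  have h₃ := h₁.convexComb h₂ t
  have hκ : 0 < f ^ 2 / (2 * g) := by positivity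
  have hi₁ := integrable_prod_of_continuousOn hΩ hμ hσ
    (h₁.continuousOn_entropicIntegrand (ε := ε) (f ^ 2 / (2 * g)))
  have hi₂ := integrable_prod_of_continuousOn hΩ hμ hσ
    (h₂.continuousOn_entropicIntegrand (ε := ε) (f ^ 2 / (2 * g)))
  have hi₃ := integrable_prod_of_continuousOn hΩ hμ hσ
    (h₃.continuousOn_entropicIntegrand (ε := ε) (f ^ 2 / (2 * g)))
  have hi := (hi₁.const_mul t).add (hi₂.const_mul (1 - t))
  rw [h₁.Dse_eq_integral hΩ hμ hσ, h₂.Dse_eq_integral hΩ hμ hσ, h₃.Dse_eq_integral hΩ hμ hσ,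
    ← integral_const_mul, ← integral_const_mul,
    ← integral_add (hi₁.const_mul t) (hi₂.const_mul (1 - t))]
  have hpt := fun p : EuclideanSpace ℝ (Fin 2) × EuclideanSpace ℝ (Fin 2) =>
    entropicIntegrand_concave hκ hε (‖p.1 - p.2‖ ^ 2 / 2) (φ₁ p.1) (ψ₁ p.2) (φ₂ p.1) (ψ₂ p.2)
      ht0 ht1
  refine lt_of_le_of_ne (integral_mono hi hi₃ fun p => (hpt p).1) fun heq => hne ?_
  have hae := (integral_eq_iff_of_ae_le hi hi₃ (ae_of_all _ fun p => (hpt p).1)).1 heq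
  have hprod : ∀ᵐ p ∂μ.prod σ, φ₁ p.1 = φ₂ p.1 ∧ ψ₁ p.2 = ψ₂ p.2 :=
    hae.mono fun p hp => (hpt p).2 hp
  have hiter := Measure.ae_ae_of_ae_prod hprod
  constructor
  · filter_upwards [hiter] with x hx
    exact hx.exists.choose_spec.1
  · exact hiter.exists.choose_spec.mono fun y hy => hy.2

/-- The Euler–Lagrange system of the entropic dual problem has a continuous solution. -/
theorem exists_eulerLagrange (hσ : IsCompact (msupport σ)) (hf : 0 < f) (hg : 0 < g)
    (hε : 0 < ε) :
    ∃ φ ψ : EuclideanSpace ℝ (Fin 2) → ℝ, Continuous φ ∧ Continuous ψ ∧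
      (∀ y, ∫ x, Real.exp ((φ x + ψ y - ‖x - y‖ ^ 2 / 2) / ε) ∂μ = 1) ∧
      ∀ x, 2 * (f ^ 2 / (2 * g)) * φ x +
        ∫ y, Real.exp ((φ x + ψ y - ‖x - y‖ ^ 2 / 2) / ε) ∂σ = 0 := by
  set c : EuclideanSpace ℝ (Fin 2) → EuclideanSpace ℝ (Fin 2) → ℝ :=
    fun x y => ‖x - y‖ ^ 2 / 2 with hc
  have hc_cont : Continuous (Function.uncurry c) := by
    simp only [hc, Function.uncurry_def]
    fun_prop
  obtain ⟨φ, hφ, hw, hw0, hφ_eq⟩ := exists_optimality_system (μ := μ) (σ := σ) hc_cont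
    (fun x y => by positivity) hε hσ (ae_mem_msupport σ)
    (k := 2 * (f ^ 2 / (2 * g))) (by positivity)
  set w := gibbsWeight μ c ε φ
  have hsplit : ∀ x y, Real.exp ((φ x + -ε * Real.log (w y) - ‖x - y‖ ^ 2 / 2) / ε) =
      Real.exp ((φ x - c x y) / ε) / w y := by
    intro x y
    have h : (φ x + -ε * Real.log (w y) - ‖x - y‖ ^ 2 / 2) / ε =
        (φ x - c x y) / ε - Real.log (w y) := by
      simp only [hc]
      field_simp
      ring
    rw [h, Real.exp_sub, Real.exp_log (hw0 y)]
  refine ⟨φ, fun y => -ε * Real.log (w y), hφ,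
    continuous_const.mul (hw.log fun y => (hw0 y).ne'), fun y => ?_, fun x => ?_⟩
  · simp only [hsplit]
    rw [integral_div]
    exact div_self (hw0 y).ne'
  · rw [← hφ_eq x]
    congr 1
    simp only [hsplit, gibbsMarginal]
    rw [← integral_const_mul]
    congr 1 with y
    rw [← mul_div_assoc, ← Real.exp_add]
    congr 2
    ring

/-- Continuous solutions of the Euler–Lagrange system maximize the entropic dual functional. -/
theorem Dse_le_of_eulerLagrange (hΩ : IsCompact Ω) (hμ : ∀ᵐ x ∂μ, x ∈ Ω)
    (hσ : IsCompact (msupport σ)) (hf : 0 < f) (hg : 0 < g) (hε : 0 < ε)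
    {φ₀ ψ₀ : EuclideanSpace ℝ (Fin 2) → ℝ} (h₀ : EntAdmissible Ω σ φ₀ ψ₀)
    (hψ₀ : ∀ y, ∫ x, Real.exp ((φ₀ x + ψ₀ y - ‖x - y‖ ^ 2 / 2) / ε) ∂μ = 1)
    (hφ₀ : ∀ x, 2 * (f ^ 2 / (2 * g)) * φ₀ x +
        ∫ y, Real.exp ((φ₀ x + ψ₀ y - ‖x - y‖ ^ 2 / 2) / ε) ∂σ = 0)
    (h : EntAdmissible Ω σ φ ψ) : Dse μ σ f g ε φ ψ ≤ Dse μ σ f g ε φ₀ ψ₀ := by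
  have hκ : 0 < f ^ 2 / (2 * g) := by positivity
  have hE := h₀.continuousOn_exp (ε := ε)
  have hEi := integrable_prod_of_continuousOn hΩ hμ hσ hE
  have hi := integrable_prod_of_continuousOn hΩ hμ hσ
    (h.continuousOn_entropicIntegrand (ε := ε) (f ^ 2 / (2 * g)))
  have hi₀ := integrable_prod_of_continuousOn hΩ hμ hσ
    (h₀.continuousOn_entropicIntegrand (ε := ε) (f ^ 2 / (2 * g)))
  have hiψ : Integrable (fun p => (ψ p.2 - ψ₀ p.2) *
      (1 - Real.exp ((φ₀ p.1 + ψ₀ p.2 - ‖p.1 - p.2‖ ^ 2 / 2) / ε))) (μ.prod σ) :=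
    integrable_prod_of_continuousOn hΩ hμ hσ
      ((h.continuousOn_snd.sub h₀.continuousOn_snd).mul (continuousOn_const.sub hE))
  have hiφ : Integrable (fun p => (φ p.1 - φ₀ p.1) * (2 * (f ^ 2 / (2 * g)) * φ₀ p.1 +
      Real.exp ((φ₀ p.1 + ψ₀ p.2 - ‖p.1 - p.2‖ ^ 2 / 2) / ε))) (μ.prod σ) :=
    integrable_prod_of_continuousOn hΩ hμ hσ
      ((h.continuousOn_fst.sub h₀.continuousOn_fst).mul
        ((continuousOn_const.mul h₀.continuousOn_fst).add hE))
  have hψ_zero : ∫ p, (ψ p.2 - ψ₀ p.2) *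
      (1 - Real.exp ((φ₀ p.1 + ψ₀ p.2 - ‖p.1 - p.2‖ ^ 2 / 2) / ε)) ∂(μ.prod σ) = 0 := by
    rw [integral_prod_symm _ hiψ]
    refine integral_eq_zero_of_ae ?_
    filter_upwards [hEi.prod_left_ae] with y hy
    simp only [Pi.zero_apply]
    rw [integral_const_mul, integral_sub (integrable_const _) hy, hψ₀ y]
    simp
  have hφ_zero : ∫ p, (φ p.1 - φ₀ p.1) * (2 * (f ^ 2 / (2 * g)) * φ₀ p.1 +
      Real.exp ((φ₀ p.1 + ψ₀ p.2 - ‖p.1 - p.2‖ ^ 2 / 2) / ε)) ∂(μ.prod σ) = 0 := by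
    rw [integral_prod _ hiφ]
    refine integral_eq_zero_of_ae ?_
    filter_upwards [hEi.prod_right_ae] with x hx
    simp only [Pi.zero_apply]
    rw [integral_const_mul, integral_add (integrable_const _) hx, integral_const]
    simp [hφ₀ x]
  rw [h.Dse_eq_integral hΩ hμ hσ, h₀.Dse_eq_integral hΩ hμ hσ]
  refine (integral_mono hi (hi₀.add (hiψ.sub hiφ)) fun p => entropicIntegrand_le_tangent hκ hε
    (‖p.1 - p.2‖ ^ 2 / 2) (φ p.1) (ψ p.2) (φ₀ p.1) (ψ₀ p.2)).trans_eq ?_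
  rw [integral_add' hi₀ (hiψ.sub hiφ), integral_sub' hiψ hiφ]
  rw [hψ_zero, hφ_zero]
  ring

end EntropicDual

/-- For every `ε > 0`, the entropic dual functional `D_{σ,ε}` is strictly
concave up to almost-everywhere equality on admissible pairs, and admits a maximizer
`(φ_ε, ψ_ε)`, unique in the sense that any two maximizers agree `μ`-a.e. in the first
component and `σ`-a.e. in the second. -/
theorem stmt_7
    (Ω : Set (EuclideanSpace ℝ (Fin 2)))
    (hΩcpt : IsCompact Ω) (hΩconv : Convex ℝ Ω) (hΩint : (interior Ω).Nonempty)
    (μ : Measure (EuclideanSpace ℝ (Fin 2)))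
    (hμ : μ = (volume Ω)⁻¹ • volume.restrict Ω)
    (f g : ℝ) (hf : 0 < f) (hg : 0 < g)
    (σ : Measure (EuclideanSpace ℝ (Fin 2))) [IsProbabilityMeasure σ]
    (hσ : ∃ K, IsCompact K ∧ σ Kᶜ = 0)
    (ε : ℝ) (hε : 0 < ε) :
    (∀ φ₁ ψ₁ φ₂ ψ₂, EntAdmissible Ω σ φ₁ ψ₁ → EntAdmissible Ω σ φ₂ ψ₂ →
      ¬(φ₁ =ᵐ[μ] φ₂ ∧ ψ₁ =ᵐ[σ] ψ₂) → ∀ t : ℝ, 0 < t → t < 1 →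
        t * Dse μ σ f g ε φ₁ ψ₁ + (1 - t) * Dse μ σ f g ε φ₂ ψ₂ <
          Dse μ σ f g ε (fun x => t * φ₁ x + (1 - t) * φ₂ x)
            (fun y => t * ψ₁ y + (1 - t) * ψ₂ y)) ∧
    (∃ φε ψε, EntAdmissible Ω σ φε ψε ∧
      (∀ φ ψ, EntAdmissible Ω σ φ ψ → Dse μ σ f g ε φ ψ ≤ Dse μ σ f g ε φε ψε) ∧
      (∀ φ' ψ', EntAdmissible Ω σ φ' ψ' →
        (∀ φ ψ, EntAdmissible Ω σ φ ψ → Dse μ σ f g ε φ ψ ≤ Dse μ σ f g ε φ' ψ') →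
        φ' =ᵐ[μ] φε ∧ ψ' =ᵐ[σ] ψε)) := by
  have hvol0 : volume Ω ≠ 0 :=
    ((isOpen_interior.measure_pos volume hΩint).trans_le (measure_mono interior_subset)).ne'
  have hvolt : volume Ω ≠ ⊤ := hΩcpt.measure_lt_top.ne
  have : IsProbabilityMeasure μ := ⟨by
    rw [hμ, Measure.smul_apply, Measure.restrict_apply_univ, smul_eq_mul,
      ENNReal.inv_mul_cancel hvol0 hvolt]⟩
  have hμΩ : ∀ᵐ x ∂μ, x ∈ Ω := by
    rw [hμ]
    exact Measure.ae_smul_measure (ae_restrict_mem hΩcpt.measurableSet) _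
  have hσc := isCompact_msupport hσ
  have hconc : ∀ φ₁ ψ₁ φ₂ ψ₂, EntAdmissible Ω σ φ₁ ψ₁ → EntAdmissible Ω σ φ₂ ψ₂ →
      ¬(φ₁ =ᵐ[μ] φ₂ ∧ ψ₁ =ᵐ[σ] ψ₂) → ∀ t : ℝ, 0 < t → t < 1 →
        t * Dse μ σ f g ε φ₁ ψ₁ + (1 - t) * Dse μ σ f g ε φ₂ ψ₂ <
          Dse μ σ f g ε (fun x => t * φ₁ x + (1 - t) * φ₂ x)
            (fun y => t * ψ₁ y + (1 - t) * ψ₂ y) :=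
    fun _ _ _ _ h₁ h₂ hne _ ht0 ht1 =>
      Dse_strictConcave hΩcpt hμΩ hσc hf hg hε h₁ h₂ hne ht0 ht1
  obtain ⟨φ₀, ψ₀, hφ, hψ, hψ_eq, hφ_eq⟩ :=
    exists_eulerLagrange (μ := μ) hσc hf hg hε
  have h₀ : EntAdmissible Ω σ φ₀ ψ₀ := ⟨hφ.continuousOn, hψ.continuousOn⟩
  have hmax : ∀ φ ψ, EntAdmissible Ω σ φ ψ → Dse μ σ f g ε φ ψ ≤ Dse μ σ f g ε φ₀ ψ₀ :=
    fun φ ψ h => Dse_le_of_eulerLagrange hΩcpt hμΩ hσc hf hg hε h₀ hψ_eq hφ_eq h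
  refine ⟨hconc, φ₀, ψ₀, h₀, hmax, fun φ' ψ' h' hmax' => ?_⟩
  by_contra hne
  have h1 := hconc φ' ψ' φ₀ ψ₀ h' h₀ hne (1 / 2) (by norm_num) (by norm_num)
  have h2 := hmax _ _ (h'.convexComb h₀ (1 / 2))
  have h3 := hmax' φ₀ ψ₀ h₀
  linarith
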